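/- arXiv:1901.09765 — 3 statements merged into one kernel-verified Lean document; each statement's English description precedes it below -/
import Mathlib

section
/- Suppose L is stochastic, φ_L is irreducible with spectral radius 1, and ρ_L is the unique density matrix fixed by φ_L. Then for every density matrix ρ ∈ M_k the Cesàro averages converge: lim_{N→∞} (1/N) Σ_{n=1}^{N} φ_L^n(ρ) = ρ_L. -/
/- STATEMENT 6: If L is stochastic, φ_L is irreducible with spectral radius 1, and ρ_L is
the unique density matrix fixed by φ_L, then for every density matrix ρ the Cesàro
averages (1/N) Σ_{n=1}^{N} φ_L^n(ρ) converge to ρ_L. -/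

open MeasureTheory Matrix Filter
open scoped ComplexOrder Topology

attribute [local instance] Matrix.frobeniusNormedAddCommGroup Matrix.frobeniusNormedSpace

noncomputable section

abbrev Mk (k : ℕ) := Matrix (Fin k) (Fin k) ℂ

instance {k : ℕ} : MeasurableSpace (Mk k) := borel _

/-- Irreducibility of a positive map on `M_k`: there are no `t > 0` and orthogonal
projection `p` onto a nonzero proper subspace of `ℂ^k` with `Φ p ≤ t • p`. -/
def IrreducibleChannel {k : ℕ} (Φ : Mk k → Mk k) : Prop :=
  ¬ ∃ (t : ℝ) (p : Mk k), 0 < t ∧ p.IsHermitian ∧ p * p = p ∧ p ≠ 0 ∧ p ≠ 1 ∧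
      (t • p - Φ p).PosSemidef

/-- The set of density matrices. -/
def densityMatrices (k : ℕ) : Set (Mk k) := {A | A.PosSemidef ∧ A.trace = 1}

lemma frobenius_norm_sq_eq_trace {k : ℕ} (B : Mk k) : ((‖B‖ ^ 2 : ℝ) : ℂ) = (Bᴴ * B).trace := by
  have h : ‖B‖ ^ 2 = ∑ i, ∑ j, ‖B i j‖ ^ 2 := by
    rw [Matrix.frobenius_norm_def, ← Real.sqrt_eq_rpow, Real.sq_sqrt (by positivity)]
    simp
  rw [h, Finset.sum_comm]
  simp only [Matrix.trace, Matrix.diag_apply, Matrix.mul_apply, Matrix.conjTranspose_apply]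
  push_cast
  refine Finset.sum_congr rfl fun i _ => Finset.sum_congr rfl fun j _ => ?_
  exact (Complex.conj_mul' _).symm

open scoped MatrixOrder in
lemma norm_le_one_of_mem_densityMatrices {k : ℕ} {A : Mk k} (hA : A ∈ densityMatrices k) :
    ‖A‖ ≤ 1 := by
  obtain ⟨B, rfl⟩ := CStarAlgebra.nonneg_iff_eq_star_mul_self.mp hA.1.nonneg
  have h1 : ‖B‖ ^ 2 = 1 := by
    have := (frobenius_norm_sq_eq_trace B).trans hA.2
    exact_mod_cast this
  calc ‖star B * B‖ ≤ ‖Bᴴ‖ * ‖B‖ := Matrix.frobenius_norm_mul _ _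
    _ = 1 := by rw [Matrix.frobenius_norm_conjTranspose, ← sq, h1]

lemma isClosed_densityMatrices (k : ℕ) : IsClosed (densityMatrices k) := by
  have h : densityMatrices k = {A : Mk k | Aᴴ = A} ∩
      (⋂ x : Fin k → ℂ, {A : Mk k | 0 ≤ star x ⬝ᵥ (A *ᵥ x)}) ∩ {A : Mk k | A.trace = 1} := by
    ext A
    simp [densityMatrices, Matrix.posSemidef_iff_dotProduct_mulVec, Matrix.IsHermitian]
  rw [h]
  refine ((isClosed_eq (by fun_prop) (by fun_prop)).inter (isClosed_iInter fun x => ?_)).inter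
    (isClosed_eq (by fun_prop) (by fun_prop))
  exact isClosed_le (by fun_prop) (by fun_prop)

lemma continuous_mul_mul_conjTranspose {k : ℕ} (ρ : Mk k) :
    Continuous fun A : Mk k => A * ρ * Aᴴ := by
  fun_prop

lemma continuous_conjTranspose_mul_self {k : ℕ} : Continuous fun A : Mk k => Aᴴ * A := by
  fun_prop

section FrobeniusTopology

/-- The topology of the Frobenius norm; it is definitionally the entrywise topology, but not
reducibly so. -/
abbrev frobeniusTopology (k : ℕ) : TopologicalSpace (Mk k) :=
  PseudoMetricSpace.toUniformSpace.toTopologicalSpace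

attribute [local instance] frobeniusTopology

instance {k : ℕ} : BorelSpace (Mk k) := ⟨rfl⟩

instance {k : ℕ} : ProperSpace (Mk k) := FiniteDimensional.proper ℂ _

lemma isCompact_densityMatrices (k : ℕ) : IsCompact (densityMatrices k) :=
  Metric.isCompact_of_isClosed_isBounded (isClosed_densityMatrices k)
    ((Metric.isBounded_closedBall (x := (0 : Mk k)) (r := 1)).subset fun A hA => by
      simpa using norm_le_one_of_mem_densityMatrices hA)

lemma convex_densityMatrices (k : ℕ) : Convex ℝ (densityMatrices k) := by
  intro A hA B hB a b ha hb hab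
  refine ⟨(hA.1.smul ha).add (hB.1.smul hb), ?_⟩
  rw [Matrix.trace_add, Matrix.trace_smul, Matrix.trace_smul, hA.2, hB.2, ← add_smul, hab, one_smul]

lemma linearMap_integral_comm {k : ℕ} {μ : Measure (Mk k)} {f : Mk k → Mk k}
    (hf : Integrable f μ) (l : Mk k →ₗ[ℂ] ℂ) : l (∫ v, f v ∂μ) = ∫ v, l (f v) ∂μ :=
  haveI : CompleteSpace (Mk k) := FiniteDimensional.complete ℂ _
  ((LinearMap.toContinuousLinearMap l).integral_comp_comm hf).symm

section Channel

variable {k : ℕ} {μ : Measure (Mk k)} {L : Mk k → Mk k}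

lemma integrable_conj (hL : Measurable L) (hsq : Integrable (fun v => ‖L v‖ ^ 2) μ) (ρ : Mk k) :
    Integrable (fun v => L v * ρ * (L v)ᴴ) μ := by
  have hc : Continuous fun A : Mk k => A * ρ * Aᴴ := continuous_mul_mul_conjTranspose ρ
  refine (hsq.mul_const ‖ρ‖).mono' (hc.measurable.comp hL).aestronglyMeasurable
    (Eventually.of_forall fun v => ?_)
  calc ‖L v * ρ * (L v)ᴴ‖ ≤ ‖L v * ρ‖ * ‖(L v)ᴴ‖ := Matrix.frobenius_norm_mul _ _
    _ ≤ ‖L v‖ * ‖ρ‖ * ‖L v‖ := by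
      rw [Matrix.frobenius_norm_conjTranspose]
      gcongr
      exact Matrix.frobenius_norm_mul _ _
    _ = ‖L v‖ ^ 2 * ‖ρ‖ := by ring

lemma integrable_conjTranspose_mul_self (hL : Measurable L)
    (hsq : Integrable (fun v => ‖L v‖ ^ 2) μ) : Integrable (fun v => (L v)ᴴ * L v) μ := by
  have hc : Continuous fun A : Mk k => Aᴴ * A := continuous_conjTranspose_mul_self
  refine hsq.mono' (hc.measurable.comp hL).aestronglyMeasurable
    (Eventually.of_forall fun v => ?_)
  calc ‖(L v)ᴴ * L v‖ ≤ ‖(L v)ᴴ‖ * ‖L v‖ := Matrix.frobenius_norm_mul _ _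
    _ = ‖L v‖ ^ 2 := by rw [Matrix.frobenius_norm_conjTranspose, sq]

lemma trace_integral_conj (hL : Measurable L) (hsq : Integrable (fun v => ‖L v‖ ^ 2) μ)
    (hstoch : (∫ v, (L v)ᴴ * L v ∂μ) = 1) (ρ : Mk k) :
    (∫ v, L v * ρ * (L v)ᴴ ∂μ).trace = ρ.trace := by
  have h1 := linearMap_integral_comm (integrable_conj hL hsq ρ) (Matrix.traceLinearMap (Fin k) ℂ ℂ)
  have h2 := linearMap_integral_comm (integrable_conjTranspose_mul_self hL hsq)
    (Matrix.traceLinearMap (Fin k) ℂ ℂ ∘ₗ LinearMap.mulRight ℂ ρ)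
  simp only [LinearMap.comp_apply, LinearMap.mulRight_apply, Matrix.traceLinearMap_apply] at h1 h2
  rw [hstoch, one_mul] at h2
  rw [h1, h2]
  refine integral_congr_ae (Eventually.of_forall fun v => ?_)
  simp only [Matrix.trace_mul_cycle (L v)]

lemma posSemidef_integral_conj (hL : Measurable L) (hsq : Integrable (fun v => ‖L v‖ ^ 2) μ)
    {ρ : Mk k} (hρ : ρ.PosSemidef) : (∫ v, L v * ρ * (L v)ᴴ ∂μ).PosSemidef := by
  have hpos (v : Mk k) : (L v * ρ * (L v)ᴴ).PosSemidef := hρ.mul_mul_conjTranspose_same _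
  refine Matrix.posSemidef_iff_dotProduct_mulVec.2 ⟨?_, fun x => ?_⟩
  · have h := ContinuousLinearEquiv.integral_comp_comm (μ := μ)
      (LinearEquiv.toContinuousLinearEquiv (Matrix.conjTransposeLinearEquiv (Fin k) (Fin k) ℝ ℂ))
      (fun v => L v * ρ * (L v)ᴴ)
    refine Eq.trans h.symm (integral_congr_ae (Eventually.of_forall fun v => ?_))
    exact (hpos v).isHermitian
  · let l : Mk k →ₗ[ℂ] ℂ :=
      { toFun := fun A => star x ⬝ᵥ (A *ᵥ x)
        map_add' := fun A B => by rw [Matrix.add_mulVec, dotProduct_add]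
        map_smul' := fun c A => by simp [Matrix.smul_mulVec, dotProduct_smul] }
    have h := linearMap_integral_comm (integrable_conj hL hsq ρ) l
    refine le_of_le_of_eq ?_ h.symm
    exact integral_nonneg fun v => (hpos v).dotProduct_mulVec_nonneg x

end Channel

end FrobeniusTopology

/-- Cesàro averages of a linear map along the orbit of a point of an invariant compact convex
set converge as soon as the map has a unique fixed point in that set. -/
lemma tendsto_cesaro_of_unique_fixed {E : Type*} [NormedAddCommGroup E] [NormedSpace ℂ E]
    [FiniteDimensional ℂ E] {K : Set E} (hK : IsCompact K)
    (hconv : Convex ℝ K) (T : Module.End ℂ E) (hT : Set.MapsTo T K K) {y : E}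
    (huniq : ∀ x ∈ K, T x = x → x = y) {x : E} (hx : x ∈ K) :
    Tendsto (fun N : ℕ => (N : ℝ)⁻¹ • ∑ n ∈ Finset.range N, (T ^ (n + 1)) x) atTop (𝓝 y) := by
  have horb (n : ℕ) : (T ^ n) x ∈ K := by
    rw [Module.End.pow_apply]
    exact hT.iterate n hx
  set f : ℕ → E := fun N => (N : ℝ)⁻¹ • ∑ n ∈ Finset.range N, (T ^ (n + 1)) x with hf
  have hfK : ∀ᶠ N in atTop, f N ∈ K := by
    filter_upwards [eventually_gt_atTop 0] with N hN
    simp only [hf, Finset.smul_sum]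
    refine hconv.sum_mem (fun _ _ => by positivity) ?_ fun n _ => horb (n + 1)
    simp [hN.ne']
  refine hK.tendsto_nhds_of_unique_mapClusterPt hfK fun z hz hcl => huniq z hz ?_
  have hsub (N : ℕ) : T (f N) - f N = (N : ℝ)⁻¹ • ((T ^ (N + 1)) x - (T ^ 1) x) := by
    have hTr (c : ℝ) (v : E) : T (c • v) = c • T v := by
      simp
    rw [← Finset.sum_range_sub (fun n => (T ^ (n + 1)) x) N, Finset.sum_sub_distrib, smul_sub]
    simp only [hf, hTr, map_sum]
    refine congrArg₂ _ (congrArg _ (Finset.sum_congr rfl fun n _ => ?_)) rfl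
    rw [pow_succ' T (n + 1), Module.End.mul_apply]
  have hlim : Tendsto (fun N => T (f N) - f N) atTop (𝓝 0) := by
    obtain ⟨C, hC⟩ := hK.isBounded.exists_norm_le
    simp only [hsub]
    refine squeeze_zero_norm (a := fun N : ℕ => (N : ℝ)⁻¹ * (C + C)) (fun N => ?_) ?_
    · rw [norm_smul, norm_inv, Real.norm_natCast]
      gcongr
      exact (norm_sub_le _ _).trans (add_le_add (hC _ (horb _)) (hC _ (horb _)))
    · simpa using (tendsto_inv_atTop_nhds_zero_nat (𝕜 := ℝ)).mul_const (C + C)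
  have hTc : Continuous T := T.continuous_of_finiteDimensional
  have hcl' := hcl.continuousAt_comp (f := fun v => T v - v) (hTc.sub continuous_id).continuousAt
  have : T z - z = 0 := by
    by_contra hne
    have hd := (disjoint_nhds_nhds.2 hne)
    exact hcl'.neBot.ne (disjoint_iff.1 (hd.mono_right hlim))
  exact sub_eq_zero.1 this

theorem stmt6 {k : ℕ} (μ : Measure (Mk k)) (L : Mk k → Mk k) (hL : Measurable L)
    (hsq : Integrable (fun v => ‖L v‖ ^ 2) μ)
    (hstoch : (∫ v, (L v)ᴴ * L v ∂μ) = 1)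
    (Φ : Module.End ℂ (Mk k))
    (hΦ : ∀ ρ : Mk k, Φ ρ = ∫ v, L v * ρ * (L v)ᴴ ∂μ)
    (hirr : IrreducibleChannel (⇑Φ))
    -- the spectral radius of `Φ` is `1`
    (hrad : (1 : ℂ) ∈ spectrum ℂ Φ ∧ ∀ z ∈ spectrum ℂ Φ, ‖z‖ ≤ 1)
    -- `ρL` is the unique fixed density matrix of `Φ`
    (ρL : Mk k) (hρL : ρL.PosSemidef) (htrρL : ρL.trace = 1) (hfix : Φ ρL = ρL)
    (huniq : ∀ ρ' : Mk k, ρ'.PosSemidef → ρ'.trace = 1 → Φ ρ' = ρ' → ρ' = ρL) :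
    ∀ ρ : Mk k, ρ.PosSemidef → ρ.trace = 1 →
      Tendsto (fun N : ℕ => (N : ℝ)⁻¹ • ∑ n ∈ Finset.range N, (Φ ^ (n + 1)) ρ)
        atTop (𝓝 ρL) := by
  intro ρ hρ htr
  refine tendsto_cesaro_of_unique_fixed (isCompact_densityMatrices k) (convex_densityMatrices k) Φ
    (fun A hA => ?_) (fun A hA hA' => huniq A hA.1 hA.2 hA') ⟨hρ, htr⟩
  rw [hΦ A]
  exact ⟨posSemidef_integral_conj hL hsq hA.1, (trace_integral_conj hL hsq hstoch A).trans hA.2⟩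

end
end

section
/- Let μ be a Borel measure on M_k whose support contains at least two points, let L ∈ B(M_k), and let ε > 0. Then there exists M ∈ B(M_k) with ‖L − M‖ < ε such that M is μ-irreducible, i.e. no nonzero proper subspace E ⊊ ℂ^k satisfies M(v)E ⊆ E for all v ∈ supp μ. In particular, the set of μ-irreducible elements is dense in B(M_k). -/
open MeasureTheory Matrix BoundedContinuousFunction
open scoped ComplexOrder

attribute [local instance] Matrix.frobeniusNormedAddCommGroup Matrix.frobeniusNormedSpace

noncomputable section

/-- The space `B(M_k)` of bounded continuous maps `L : M_k → M_k`, with the sup norm. -/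
abbrev BMk (k : ℕ) := BoundedContinuousFunction (Mk k) (Mk k)

/-- The support of a measure on `M_k`: points all of whose open neighborhoods have
positive measure. -/
def measSupport {k : ℕ} (μ : Measure (Mk k)) : Set (Mk k) :=
  {v | ∀ U : Set (Mk k), IsOpen U → v ∈ U → 0 < μ U}

/-- A subspace `E ⊆ ℂ^k` is `(L,μ)`-invariant if `L(v) E ⊆ E` for all `v ∈ supp μ`. -/
def InvariantSub {k : ℕ} (μ : Measure (Mk k)) (L : Mk k → Mk k)
    (E : Submodule ℂ (Fin k → ℂ)) : Prop :=
  ∀ v ∈ measSupport μ, ∀ x ∈ E, (L v).mulVec x ∈ E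

/-- `L` is `μ`-irreducible: the only nonzero `(L,μ)`-invariant subspace of `ℂ^k`
is `ℂ^k` itself. -/
def MuIrreducible {k : ℕ} (μ : Measure (Mk k)) (L : Mk k → Mk k) : Prop :=
  ∀ E : Submodule ℂ (Fin k → ℂ), InvariantSub μ L E → E = ⊥ ∨ E = ⊤

open Filter Topology

/-- The `k ^ 2` words `Y ^ i * X * Y ^ (-j)` (with `-j` read modulo `k`), as columns of a
square matrix. -/
def wordMatrix {R : Type*} [CommRing R] {k : ℕ} [NeZero k] (X Y : Matrix (Fin k) (Fin k) R) :
    Matrix (Fin k × Fin k) (Fin k × Fin k) R :=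
  of fun p q => (Y ^ (q.1 : ℕ) * X * Y ^ ((-q.2 : Fin k) : ℕ)) p.1 p.2

/-- The matrix of the cyclic shift `e_b ↦ e_{b+1}`. -/
def cyclicShift (R : Type*) [CommRing R] (k : ℕ) [NeZero k] : Matrix (Fin k) (Fin k) R :=
  of fun a b => if a = b + 1 then 1 else 0

lemma cyclicShift_pow_apply (R : Type*) [CommRing R] (k : ℕ) [NeZero k] (m : ℕ) (a b : Fin k) :
    (cyclicShift R k ^ m) a b = if a = b + Fin.ofNat k m then 1 else 0 := by
  induction m generalizing b with
  | zero => simp [Matrix.one_apply]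
  | succ m ih =>
    have h : b + 1 + Fin.ofNat k m = b + Fin.ofNat k (m + 1) := by
      ext
      simp [Fin.val_add, Nat.add_mod, add_comm, add_left_comm]
    rw [pow_succ, Matrix.mul_apply, ← h, ← ih (b + 1)]
    simp only [cyclicShift]
    simp only [of_apply, mul_ite, mul_one, mul_zero, Finset.sum_ite_eq', Finset.mem_univ, if_true]

lemma wordMatrix_single_cyclicShift (R : Type*) [CommRing R] (k : ℕ) [NeZero k] :
    wordMatrix (Matrix.single 0 0 1) (cyclicShift R k) = 1 := by
  ext ⟨a, b⟩ ⟨i, j⟩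
  have h : (0 = b + -j) ↔ b = j := by
    rw [← sub_eq_add_neg, eq_comm, sub_eq_zero]
  simp only [wordMatrix, of_apply, Matrix.mul_apply, Matrix.single_apply, cyclicShift_pow_apply,
    Matrix.one_apply, Prod.mk.injEq]
  simp [Finset.sum_ite_eq, ite_and, h]
  grind

lemma map_wordMatrix {R S : Type*} [CommRing R] [CommRing S] {k : ℕ} [NeZero k] (f : R →+* S)
    (X Y : Matrix (Fin k) (Fin k) R) :
    f.mapMatrix (wordMatrix X Y) = wordMatrix (f.mapMatrix X) (f.mapMatrix Y) := by
  ext p q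
  simp only [wordMatrix, ← map_pow, ← map_mul]
  rfl

/-- A subspace invariant under all matrices is trivial. -/
lemma eq_bot_or_eq_top_of_single_mulVec_mem {K : Type*} [Field K] {k : ℕ}
    (E : Submodule K (Fin k → K)) (h : ∀ a b, ∀ x ∈ E, Matrix.single a b (1 : K) *ᵥ x ∈ E) :
    E = ⊥ ∨ E = ⊤ := by
  refine or_iff_not_imp_left.2 fun hE => ?_
  obtain ⟨x, hx, hx0⟩ := E.ne_bot_iff.1 hE
  obtain ⟨b, hb⟩ := Function.ne_iff.1 hx0
  have hsingle : ∀ a, Pi.single a (1 : K) ∈ E := fun a => by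
    have := E.smul_mem (x b)⁻¹ (h a b x hx)
    convert this using 1
    ext c
    simp only [Matrix.single_mulVec, Pi.smul_apply, smul_eq_mul, one_mul]
    by_cases hc : c = a
    · subst hc; simp_all
    · simp [hc]
  refine eq_top_iff.2 fun y _ => ?_
  rw [pi_eq_sum_univ' y]
  refine E.sum_mem fun a _ => E.smul_mem _ ?_
  convert hsingle a using 1

lemma eq_bot_or_eq_top_of_det_wordMatrix_ne_zero {K : Type*} [Field K] {k : ℕ} [NeZero k]
    {A B : Matrix (Fin k) (Fin k) K} (hdet : (wordMatrix A B).det ≠ 0)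
    (E : Submodule K (Fin k → K)) (hA : ∀ x ∈ E, A *ᵥ x ∈ E) (hB : ∀ x ∈ E, B *ᵥ x ∈ E) :
    E = ⊥ ∨ E = ⊤ := by
  have hpow : ∀ (m : ℕ), ∀ x ∈ E, (B ^ m) *ᵥ x ∈ E := by
    intro m
    induction m with
    | zero => simp
    | succ m ih =>
        intro x hx
        rw [pow_succ, ← Matrix.mulVec_mulVec]
        exact ih _ (hB x hx)
  refine eq_bot_or_eq_top_of_single_mulVec_mem E fun a b x hx => ?_
  have hinv : wordMatrix A B * (wordMatrix A B)⁻¹ = 1 :=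
    Matrix.mul_nonsing_inv _ (isUnit_iff_ne_zero.2 hdet)
  have hsum : Matrix.single a b (1 : K) = ∑ q : Fin k × Fin k,
      (wordMatrix A B)⁻¹ q (a, b) • (B ^ (q.1 : ℕ) * A * B ^ ((-q.2 : Fin k) : ℕ)) := by
    ext c d
    have := congrFun (congrFun hinv (c, d)) (a, b)
    rw [Matrix.mul_apply, Matrix.one_apply] at this
    rw [Matrix.sum_apply, Matrix.single_apply]
    simp only [Matrix.smul_apply, smul_eq_mul]
    rw [← (Finset.sum_congr rfl fun q _ => mul_comm _ _ : _ = _)]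
    refine Eq.trans ?_ this.symm
    simp [eq_comm]
  rw [hsum, Matrix.sum_mulVec]
  refine E.sum_mem fun q _ => ?_
  rw [Matrix.smul_mulVec, ← Matrix.mulVec_mulVec, ← Matrix.mulVec_mulVec]
  exact E.smul_mem _ (hpow _ _ (hA _ (hpow _ _ hx)))

open Polynomial in
lemma finite_det_wordMatrix_eq_zero {K : Type*} [Field K] {k : ℕ} [NeZero k]
    (A B X Y : Matrix (Fin k) (Fin k) K) (h : (wordMatrix X Y).det ≠ 0) :
    {t : K | (wordMatrix (X + t • A) (Y + t • B)).det = 0}.Finite := by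
  let line (U V : Matrix (Fin k) (Fin k) K) : Matrix (Fin k) (Fin k) K[X] :=
    of fun a b => C (U a b) + Polynomial.X * C (V a b)
  have hline : ∀ t U V, (evalRingHom t).mapMatrix (line U V) = U + t • V := fun t U V => by
    ext a b
    simp [line, mul_comm t]
  set P : K[X] := (wordMatrix (line X A) (line Y B)).det with hP
  have heval : ∀ t, P.eval t = (wordMatrix (X + t • A) (Y + t • B)).det := fun t => by
    rw [← coe_evalRingHom, hP, RingHom.map_det, map_wordMatrix, hline, hline]
  have hP0 : P ≠ 0 := fun h0 => h <| by
    have := heval 0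
    simpa [h0, eq_comm] using this
  simp_rw [← heval]
  exact Polynomial.finite_setOfPred_isRoot hP0

/-- Any two complex matrices have arbitrarily small perturbations without a common nontrivial
invariant subspace. -/
lemma exists_small_perturbation_irreducible {k : ℕ} (A B : Mk k) {δ : ℝ} (hδ : 0 < δ) :
    ∃ C D : Mk k, ‖C‖ < δ ∧ ‖D‖ < δ ∧ ∀ E : Submodule ℂ (Fin k → ℂ),
      (∀ x ∈ E, (A + C) *ᵥ x ∈ E) → (∀ x ∈ E, (B + D) *ᵥ x ∈ E) → E = ⊥ ∨ E = ⊤ := by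
  obtain rfl | hk := eq_or_ne k 0
  · exact ⟨0, 0, by simpa, by simpa, fun E _ _ => Or.inl (Subsingleton.elim _ _)⟩
  have : NeZero k := ⟨hk⟩
  let X : Mk k := Matrix.single 0 0 1
  let Y : Mk k := cyclicShift ℂ k
  have hsmall : ∀ Z : Mk k, ∀ᶠ n : ℕ in atTop, ‖(n : ℂ)⁻¹ • Z‖ < δ := fun Z => by
    have h : Tendsto (fun n : ℕ => ‖(n : ℂ)⁻¹‖ * ‖Z‖) atTop (𝓝 0) := by
      simpa using (tendsto_inv_atTop_nhds_zero_nat (𝕜 := ℂ)).norm.mul_const ‖Z‖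
    simpa only [norm_smul] using h.eventually_lt_const hδ
  have hdet : ∀ᶠ n : ℕ in atTop, (wordMatrix (X + (n : ℂ) • A) (Y + (n : ℂ) • B)).det ≠ 0 := by
    rw [← Nat.cofinite_eq_atTop]
    have hfin := finite_det_wordMatrix_eq_zero A B X Y
      (by rw [wordMatrix_single_cyclicShift, Matrix.det_one]; exact one_ne_zero)
    exact (Nat.cast_injective (R := ℂ)).tendsto_cofinite.eventually hfin.eventually_cofinite_notMem
  obtain ⟨n, hX, hY, hn, hn0⟩ :=
    ((hsmall X).and ((hsmall Y).and (hdet.and (eventually_ne_atTop 0)))).exists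
  have hn0' : (n : ℂ) ≠ 0 := Nat.cast_ne_zero.2 hn0
  have hscale : ∀ (U V : Mk k) (E : Submodule ℂ (Fin k → ℂ)),
      (∀ x ∈ E, (U + (n : ℂ)⁻¹ • V) *ᵥ x ∈ E) → ∀ x ∈ E, (V + (n : ℂ) • U) *ᵥ x ∈ E := by
    intro U V E h x hx
    have heq : V + (n : ℂ) • U = (n : ℂ) • (U + (n : ℂ)⁻¹ • V) := by
      rw [smul_add, smul_inv_smul₀ hn0', add_comm]
    rw [heq, Matrix.smul_mulVec]
    exact E.smul_mem _ (h x hx)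
  exact ⟨_, _, hX, hY, fun E hA hB =>
    eq_bot_or_eq_top_of_det_wordMatrix_ne_zero hn E (hscale _ _ _ hA) (hscale _ _ _ hB)⟩

/-- Bounded continuous functions can be perturbed by small prescribed amounts at two points. -/
lemma exists_perturbation_at_two_points {α F : Type*} [TopologicalSpace α] [NormalSpace α]
    [T1Space α] [NormedAddCommGroup F] [NormedSpace ℝ F] (L : BoundedContinuousFunction α F)
    {v₁ v₂ : α} (hne : v₁ ≠ v₂) {δ : ℝ} {C D : F} (hC : ‖C‖ ≤ δ) (hD : ‖D‖ ≤ δ) :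
    ∃ M : BoundedContinuousFunction α F, ‖L - M‖ ≤ δ ∧ M v₁ = L v₁ + C ∧ M v₂ = L v₂ + D := by
  obtain ⟨f, hf0, hf1, hf⟩ := exists_continuous_zero_one_of_isClosed
    (isClosed_singleton (x := v₁)) (isClosed_singleton (x := v₂))
    (Set.disjoint_singleton.2 hne)
  have hbound : ∀ v, ‖(1 - f v) • C + f v • D‖ ≤ δ := fun v => by
    obtain ⟨h0, h1⟩ := hf v
    have := (convex_closedBall (0 : F) δ) (mem_closedBall_zero_iff.2 hC)
      (mem_closedBall_zero_iff.2 hD) (sub_nonneg.2 h1) h0 (sub_add_cancel _ _)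
    exact mem_closedBall_zero_iff.1 this
  let g : BoundedContinuousFunction α F :=
    BoundedContinuousFunction.ofNormedAddCommGroup (fun v => (1 - f v) • C + f v • D)
      (by fun_prop) δ hbound
  have h1 : f v₁ = 0 := hf0 rfl
  have h2 : f v₂ = 1 := hf1 rfl
  refine ⟨L + g, ?_, ?_, ?_⟩
  · rw [sub_add_cancel_left, norm_neg]
    exact BoundedContinuousFunction.norm_ofNormedAddCommGroup_le _
      ((norm_nonneg C).trans hC) hbound
  · simp [g, h1]
  · simp [g, h2]

lemma exists_muIrreducible_norm_sub_lt {k : ℕ} (μ : Measure (Mk k))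
    (hsupp : ∃ v₁ v₂ : Mk k, v₁ ∈ measSupport μ ∧ v₂ ∈ measSupport μ ∧ v₁ ≠ v₂)
    (L : BMk k) {ε : ℝ} (hε : 0 < ε) : ∃ M : BMk k, ‖L - M‖ < ε ∧ MuIrreducible μ (⇑M) := by
  obtain ⟨v₁, v₂, h₁, h₂, hne⟩ := hsupp
  obtain ⟨C, D, hC, hD, hirr⟩ :=
    exists_small_perturbation_irreducible (L v₁) (L v₂) (half_pos hε)
  have : NormalSpace (Mk k) := inferInstanceAs (NormalSpace (Fin k → Fin k → ℂ))
  have : T1Space (Mk k) := inferInstanceAs (T1Space (Fin k → Fin k → ℂ))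
  obtain ⟨M, hM, hM₁, hM₂⟩ := exists_perturbation_at_two_points L hne hC.le hD.le
  refine ⟨M, hM.trans_lt (half_lt_self hε), fun E hE => hirr E ?_ ?_⟩
  · rw [← hM₁]; exact hE v₁ h₁
  · rw [← hM₂]; exact hE v₂ h₂

theorem stmt16 {k : ℕ} (μ : Measure (Mk k))
    (hsupp : ∃ v₁ v₂ : Mk k, v₁ ∈ measSupport μ ∧ v₂ ∈ measSupport μ ∧ v₁ ≠ v₂)
    (L : BMk k) (ε : ℝ) (hε : 0 < ε) :
    (∃ M : BMk k, ‖L - M‖ < ε ∧ MuIrreducible μ (⇑M)) ∧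
    -- in particular the set of `μ`-irreducible elements is dense in `B(M_k)`
    Dense {M : BMk k | MuIrreducible μ (⇑M)} := by
  refine ⟨exists_muIrreducible_norm_sub_lt μ hsupp L hε, Metric.dense_iff.2 fun N r hr => ?_⟩
  obtain ⟨M, hM, hirr⟩ := exists_muIrreducible_norm_sub_lt μ hsupp N hr
  exact ⟨M, by rwa [Metric.mem_ball, dist_comm, dist_eq_norm], hirr⟩

end
end

section
/- For any fixed Borel measure μ on M_k, the set B_μ(M_k) = {L ∈ B(M_k) : L is μ-irreducible} is open in B(M_k) (with respect to the sup norm). -/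
open MeasureTheory Matrix BoundedContinuousFunction
open scoped ComplexOrder

attribute [local instance] Matrix.frobeniusNormedAddCommGroup Matrix.frobeniusNormedSpace

noncomputable section

/-- The star projections of `M_k` other than `0` and `1`, with the last condition expressed
through the norm so that it is visibly closed. -/
def properProjections (k : ℕ) : Set (Mk k) :=
  {P | P * P = P ∧ star P = P ∧ 1 ≤ ‖P‖ ∧ 1 ≤ ‖1 - P‖}

theorem one_le_norm_of_isIdempotentElem {k : ℕ} {P : Mk k} (hP : P * P = P) (h0 : P ≠ 0) :
    1 ≤ ‖P‖ := by
  have h : ‖P * P‖ ≤ ‖P‖ * ‖P‖ := Matrix.frobenius_norm_mul P P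
  rw [hP] at h
  exact le_of_mul_le_mul_right (by simpa using h) (norm_pos_iff.mpr h0)

theorem mem_properProjections {k : ℕ} {P : Mk k} :
    P ∈ properProjections k ↔ IsStarProjection P ∧ P ≠ 0 ∧ P ≠ 1 := by
  constructor
  · rintro ⟨hi, hs, h0, h1⟩
    refine ⟨⟨hi, hs⟩, ?_, ?_⟩
    · rintro rfl
      norm_num at h0
    · rintro rfl
      norm_num at h1
  · rintro ⟨hP, h0, h1⟩
    exact ⟨hP.isIdempotentElem, hP.isSelfAdjoint,
      one_le_norm_of_isIdempotentElem hP.isIdempotentElem h0,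
      one_le_norm_of_isIdempotentElem hP.one_sub.isIdempotentElem (sub_ne_zero.mpr h1.symm)⟩

theorem norm_apply_le_one_of_isStarProjection {k : ℕ} {P : Mk k} (hP : IsStarProjection P)
    (i j : Fin k) : ‖P i j‖ ≤ 1 := by
  have hu : 2 * P - 1 ∈ Matrix.unitaryGroup (Fin k) ℂ :=
    hP.two_mul_sub_one_mem_unitary
  have h := entry_norm_bound_of_unitary hu i j
  have h1 : ‖(1 : Mk k) i j‖ ≤ 1 := by
    rw [Matrix.one_apply]
    split_ifs <;> simp
  have h2 : 2 * P i j = (2 * P - 1) i j + (1 : Mk k) i j := by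
    simp [two_mul]
  have h3 : ‖2 * P i j‖ ≤ 1 + 1 := h2 ▸ (norm_add_le _ _).trans (add_le_add h h1)
  rw [norm_mul, Complex.norm_ofNat] at h3
  linarith

theorem isCompact_properProjections (k : ℕ) : IsCompact (properProjections k) := by
  have hc : IsCompact (Set.univ.pi fun _ : Fin k ↦ Set.univ.pi fun _ : Fin k ↦
      Metric.closedBall (0 : ℂ) 1) :=
    isCompact_univ_pi fun _ ↦ isCompact_univ_pi fun _ ↦ isCompact_closedBall _ _
  refine IsCompact.of_isClosed_subset (X := Mk k) hc ?_ ?_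
  · refine (isClosed_eq (by fun_prop) continuous_id).inter
      ((isClosed_eq (by fun_prop) continuous_id).inter
        ((isClosed_le continuous_const continuous_norm).inter
          (isClosed_le (g := fun P : Mk k ↦ ‖1 - P‖) continuous_const ?_)))
    exact continuous_norm.comp (continuous_const.sub continuous_id)
  · intro P hP i _ j _
    simpa using norm_apply_le_one_of_isStarProjection (mem_properProjections.mp hP).1 i j

/-- Every subspace of `ℂ^k` is the set of fixed points of a star projection. -/
theorem exists_isStarProjection_mem_iff {k : ℕ} (E : Submodule ℂ (Fin k → ℂ)) :
    ∃ P : Mk k, IsStarProjection P ∧ ∀ x, x ∈ E ↔ P *ᵥ x = x := by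
  let F : Submodule ℂ (EuclideanSpace ℂ (Fin k)) :=
    E.comap (WithLp.linearEquiv 2 ℂ (Fin k → ℂ)).toLinearMap
  let e := Matrix.toEuclideanCLM (n := Fin k) (𝕜 := ℂ)
  have hF : IsStarProjection F.starProjection := isStarProjection_starProjection
  refine ⟨e.symm F.starProjection, ⟨?_, ?_⟩, fun x ↦ ?_⟩
  · exact (e.symm.map_mul' _ _).symm.trans (congrArg e.symm hF.isIdempotentElem)
  · exact (e.symm.map_star' _).symm.trans (congrArg e.symm hF.isSelfAdjoint)
  have h := Submodule.starProjection_eq_self_iff (K := F) (v := WithLp.toLp 2 x)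
  have h2 : F.starProjection (WithLp.toLp 2 x) =
      WithLp.toLp 2 (e.symm F.starProjection *ᵥ x) := by
    rw [← Matrix.toEuclideanCLM_toLp]
    exact congrArg (· (WithLp.toLp 2 x)) (e.apply_symm_apply F.starProjection).symm
  rw [h2] at h
  exact h.symm.trans (WithLp.toLp_injective 2).eq_iff

theorem invariantSub_iff_of_mem_iff {k : ℕ} (μ : Measure (Mk k)) (L : Mk k → Mk k)
    {E : Submodule ℂ (Fin k → ℂ)} {P : Mk k} (hP : P * P = P)
    (hE : ∀ x, x ∈ E ↔ P *ᵥ x = x) :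
    InvariantSub μ L E ↔ ∀ v ∈ measSupport μ, P * (L v * P) = L v * P := by
  refine forall₂_congr fun v _ ↦ ⟨fun h ↦ ?_, fun h x hx ↦ ?_⟩
  · refine Matrix.ext_of_mulVec_single fun i ↦ ?_
    have hx : P *ᵥ Pi.single i 1 ∈ E := by rw [hE, Matrix.mulVec_mulVec, hP]
    simpa only [Matrix.mulVec_mulVec, Matrix.mul_assoc] using (hE _).mp (h _ hx)
  · rw [hE] at hx ⊢
    have := congrArg (· *ᵥ x) h
    simpa only [← Matrix.mulVec_mulVec, hx] using this

theorem not_muIrreducible_iff {k : ℕ} (μ : Measure (Mk k)) (L : Mk k → Mk k) :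
    ¬ MuIrreducible μ L ↔
      ∃ P ∈ properProjections k, ∀ v ∈ measSupport μ, P * (L v * P) = L v * P := by
  simp only [MuIrreducible, mem_properProjections]
  push Not
  constructor
  · rintro ⟨E, hinv, hbot, htop⟩
    obtain ⟨P, hP, hE⟩ := exists_isStarProjection_mem_iff E
    refine ⟨P, ⟨hP, ?_, ?_⟩, (invariantSub_iff_of_mem_iff μ L hP.isIdempotentElem hE).mp hinv⟩
    · rintro rfl
      exact hbot ((Submodule.eq_bot_iff E).mpr fun x hx ↦ by simpa using ((hE x).mp hx).symm)
    · rintro rfl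
      exact htop (Submodule.eq_top_iff'.mpr fun x ↦ (hE x).mpr (Matrix.one_mulVec x))
  · rintro ⟨P, ⟨hP, h0, h1⟩, hinv⟩
    let E : Submodule ℂ (Fin k → ℂ) := LinearMap.eqLocus P.mulVecLin LinearMap.id
    have hE : ∀ x, x ∈ E ↔ P *ᵥ x = x := fun x ↦ Iff.rfl
    refine ⟨E, (invariantSub_iff_of_mem_iff μ L hP.isIdempotentElem hE).mpr hinv, ?_, ?_⟩
    · intro hbot
      refine h0 (Matrix.ext_of_mulVec_single fun i ↦ ?_)
      have hx : P *ᵥ Pi.single i 1 ∈ E := by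
        rw [hE, Matrix.mulVec_mulVec, hP.isIdempotentElem.eq]
      rw [hbot, Submodule.mem_bot] at hx
      rw [hx, Matrix.zero_mulVec]
    · intro htop
      refine h1 (Matrix.ext_of_mulVec_single fun i ↦ ?_)
      rw [Matrix.one_mulVec]
      exact (hE _).mp (htop ▸ Submodule.mem_top)

theorem stmt17 {k : ℕ} (μ : Measure (Mk k)) :
    IsOpen {L : BMk k | MuIrreducible μ (⇑L)} := by
  rw [← isClosed_compl_iff]
  have : CompactSpace (properProjections k) :=
    isCompact_iff_compactSpace.mp (isCompact_properProjections k)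
  let T : Set (BMk k × properProjections k) :=
    {p | ∀ v ∈ measSupport μ, p.2.1 * (p.1 v * p.2.1) = p.1 v * p.2.1}
  have hT : IsClosed T := by
    have hT' : T = ⋂ v ∈ measSupport μ,
        {p | p.2.1 * (p.1 v * p.2.1) = p.1 v * p.2.1} := by
      ext p
      simp [T]
    rw [hT']
    refine isClosed_biInter fun v _ ↦ ?_
    have h1 : Continuous fun p : BMk k × properProjections k ↦ p.1 v :=
      (continuous_eval_const v).comp continuous_fst
    have h2 : Continuous fun p : BMk k × properProjections k ↦ p.2.1 :=
      continuous_subtype_val.comp continuous_snd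
    exact isClosed_eq (h2.matrix_mul (h1.matrix_mul h2)) (h1.matrix_mul h2)
  convert isClosedMap_fst_of_compactSpace T hT
  ext L
  simp [T, not_muIrreducible_iff]

end
end
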